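/- arXiv:2509.26045 — 3 statements merged into one kernel-verified Lean document; each statement's English description precedes it below -/
import Mathlib

section
/- Let E be a real normed vector space, let s ⊆ E be a convex set, and let f : E → ℝ be twice differentiable on s with second derivative bounded in operator norm by M ≥ 0 on s. Let θ_1, …, θ_S ∈ s, let α_1, …, α_S be nonnegative reals with Σ_{i=1}^S α_i = 1, and set θ̄ = Σ_{i=1}^S α_i θ_i (which lies in s by convexity). Then |Σ_{i=1}^S α_i f(θ_i) − f(θ̄)| ≤ (M/2) · Σ_{i=1}^S α_i ‖θ_i − θ̄‖². In particular, writing Δ = max_{1≤i≤S} ‖θ_i − θ̄‖, one has |Σ_{i=1}^S α_i f(θ_i) − f(θ̄)| ≤ (M/2) · Δ². -/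
open Finset

/-- First-order Taylor estimate on a convex set: if the derivative `f'` of `f` has itself a
derivative bounded by `M` on `s`, the remainder is at most `(M / 2) * ‖y - x‖ ^ 2`. -/
theorem Convex.norm_taylor_remainder_le_of_norm_hasFDerivWithin_le
    {E F : Type*} [NormedAddCommGroup E] [NormedSpace ℝ E]
    [NormedAddCommGroup F] [NormedSpace ℝ F]
    {s : Set E} (hs : Convex ℝ s)
    {f : E → F} {f' : E → E →L[ℝ] F} {f'' : E → E →L[ℝ] E →L[ℝ] F}
    (hf' : ∀ x ∈ s, HasFDerivWithinAt f (f' x) s x)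
    (hf'' : ∀ x ∈ s, HasFDerivWithinAt f' (f'' x) s x)
    {M : ℝ} (hbound : ∀ x ∈ s, ‖f'' x‖ ≤ M)
    {x y : E} (hx : x ∈ s) (hy : y ∈ s) :
    ‖f y - f x - f' x (y - x)‖ ≤ (M / 2) * ‖y - x‖ ^ 2 := by
  have hmem : Set.MapsTo (fun t : ℝ => x + t • (y - x)) (Set.Icc 0 1) s :=
    fun t ht => hs.add_smul_sub_mem hx hy ht
  have hder : ∀ t ∈ Set.Icc (0 : ℝ) 1,
      HasDerivWithinAt (fun t : ℝ => f (x + t • (y - x)) - f x - t • f' x (y - x))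
        (f' (x + t • (y - x)) (y - x) - f' x (y - x)) (Set.Icc 0 1) t := by
    intro t ht
    have hline : HasDerivWithinAt (fun t : ℝ => x + t • (y - x)) (y - x) (Set.Icc 0 1) t := by
      simpa using ((hasDerivWithinAt_id t (Set.Icc 0 1)).smul_const (y - x)).const_add x
    have hcomp := (hf' _ (hmem ht)).comp_hasDerivWithinAt t hline hmem
    have hlin := (hasDerivWithinAt_id t (Set.Icc 0 1)).smul_const (f' x (y - x))
    simpa using (hcomp.sub_const (f x)).fun_sub hlin
  have hB : ∀ t : ℝ, HasDerivAt (fun t : ℝ => (M / 2) * ‖y - x‖ ^ 2 * t ^ 2)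
      (M * ‖y - x‖ ^ 2 * t) t := by
    intro t
    refine ((hasDerivAt_pow 2 t).const_mul ((M / 2) * ‖y - x‖ ^ 2)).congr_deriv ?_
    push_cast
    ring
  have key := image_norm_le_of_norm_deriv_right_le_deriv_boundary
    (fun t ht => (hder t ht).continuousWithinAt)
    (fun t ht => (hder t (Set.Ico_subset_Icc_self ht)).mono_of_mem_nhdsWithin
      (Icc_mem_nhdsGE_of_mem ht))
    (by simp) hB ?_ (Set.right_mem_Icc.2 zero_le_one)
  · simpa using key
  · intro t ht
    have hlip := hs.norm_image_sub_le_of_norm_hasFDerivWithin_le hf'' hbound hx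
      (hmem (Set.Ico_subset_Icc_self ht))
    rw [add_sub_cancel_left, norm_smul, Real.norm_of_nonneg ht.1] at hlip
    calc ‖f' (x + t • (y - x)) (y - x) - f' x (y - x)‖
        = ‖(f' (x + t • (y - x)) - f' x) (y - x)‖ := by simp
      _ ≤ M * (t * ‖y - x‖) * ‖y - x‖ := ContinuousLinearMap.le_of_opNorm_le _ hlip _
      _ = M * ‖y - x‖ ^ 2 * t := by ring

/-- Quantitative Lemma 1 (functional approximation): for a twice differentiable
function `f` on a convex set `s` with second derivative bounded by `M`, the ensemble
value `∑ αᵢ f(θᵢ)` differs from the value at the weight average `θ̄ = ∑ αᵢ • θᵢ`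
by at most `(M/2) ∑ αᵢ ‖θᵢ - θ̄‖²`, and in particular by at most `(M/2) Δ²` where
`Δ = maxᵢ ‖θᵢ - θ̄‖`. -/
theorem tea_functional_approximation
    {E : Type*} [NormedAddCommGroup E] [NormedSpace ℝ E]
    (s : Set E) (hs : Convex ℝ s)
    (f : E → ℝ) (f' : E → E →L[ℝ] ℝ) (f'' : E → E →L[ℝ] E →L[ℝ] ℝ)
    (hf' : ∀ x ∈ s, HasFDerivWithinAt f (f' x) s x)
    (hf'' : ∀ x ∈ s, HasFDerivWithinAt f' (f'' x) s x)
    (M : ℝ) (hM : 0 ≤ M) (hbound : ∀ x ∈ s, ‖f'' x‖ ≤ M)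
    (S : ℕ) (hS : 0 < S)
    (θ : Fin S → E) (hθ : ∀ i, θ i ∈ s)
    (α : Fin S → ℝ) (hα : ∀ i, 0 ≤ α i) (hα1 : ∑ i, α i = 1)
    (θbar : E) (hθbar : θbar = ∑ i, α i • θ i) :
    |(∑ i, α i * f (θ i)) - f θbar| ≤ (M / 2) * ∑ i, α i * ‖θ i - θbar‖ ^ 2 ∧
    |(∑ i, α i * f (θ i)) - f θbar| ≤
      (M / 2) *
        (Finset.univ.sup' ⟨⟨0, hS⟩, Finset.mem_univ _⟩ (fun i => ‖θ i - θbar‖)) ^ 2 := by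
  have hmem : θbar ∈ s := hθbar ▸ hs.sum_mem (fun i _ => hα i) hα1 (fun i _ => hθ i)
  have hlin : ∑ i, α i * f' θbar (θ i - θbar) = 0 := by
    have hzero : ∑ i, α i • (θ i - θbar) = 0 := by
      simp only [smul_sub, Finset.sum_sub_distrib, ← Finset.sum_smul, hα1, one_smul, ← hθbar,
        sub_self]
    simpa using congrArg (f' θbar) hzero
  have hsum : (∑ i, α i * f (θ i)) - f θbar
      = ∑ i, α i * (f (θ i) - f θbar - f' θbar (θ i - θbar)) := by
    simp only [mul_sub (α _), Finset.sum_sub_distrib, ← Finset.sum_mul, hα1, one_mul, hlin,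
      sub_zero]
  have hmain : |(∑ i, α i * f (θ i)) - f θbar| ≤ (M / 2) * ∑ i, α i * ‖θ i - θbar‖ ^ 2 := by
    rw [hsum, Finset.mul_sum]
    refine (Finset.abs_sum_le_sum_abs _ _).trans (Finset.sum_le_sum fun i _ => ?_)
    rw [abs_mul, abs_of_nonneg (hα i), mul_left_comm]
    exact mul_le_mul_of_nonneg_left
      (hs.norm_taylor_remainder_le_of_norm_hasFDerivWithin_le hf' hf'' hbound hmem (hθ i)) (hα i)
  refine ⟨hmain, hmain.trans (mul_le_mul_of_nonneg_left ?_ (by positivity))⟩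
  set Δ := Finset.univ.sup' ⟨⟨0, hS⟩, Finset.mem_univ _⟩ (fun i => ‖θ i - θbar‖)
  calc ∑ i, α i * ‖θ i - θbar‖ ^ 2 ≤ ∑ i, α i * Δ ^ 2 := by
        gcongr with i
        · exact hα i
        · exact Finset.le_sup' (fun i => ‖θ i - θbar‖) (Finset.mem_univ i)
    _ = Δ ^ 2 := by rw [← Finset.sum_mul, hα1, one_mul]
end

section
/- Let E be a real normed vector space, let s ⊆ E be a convex set, and let f : E → ℝ be twice differentiable on s with second derivative bounded in operator norm by M ≥ 0 on s. Let θ_1, …, θ_S ∈ s, let α_1, …, α_S be nonnegative reals with Σ_{i=1}^S α_i = 1, set θ̄ = Σ_{i=1}^S α_i θ_i, and let Δ = max_{1≤i≤S} ‖θ_i − θ̄‖. Let ℓ : ℝ → ℝ be L-Lipschitz. Then |ℓ(f(θ̄)) − ℓ(Σ_{i=1}^S α_i f(θ_i))| ≤ (L·M/2) · Δ². -/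
open Finset NNReal

/-- First-order Taylor estimate on a convex set: if the second derivative of `f` is bounded by `M`
on `s`, the linear approximation of `f` at `a` has error at most `M / 2 * ‖b - a‖ ^ 2`. -/
theorem Convex.norm_image_sub_sub_fderiv_le {E F : Type*}
    [NormedAddCommGroup E] [NormedSpace ℝ E] [NormedAddCommGroup F] [NormedSpace ℝ F]
    {s : Set E} (hs : Convex ℝ s) {f : E → F} {f' : E → E →L[ℝ] F}
    {f'' : E → E →L[ℝ] E →L[ℝ] F}
    (hf' : ∀ x ∈ s, HasFDerivWithinAt f (f' x) s x)
    (hf'' : ∀ x ∈ s, HasFDerivWithinAt f' (f'' x) s x)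
    {M : ℝ} (hbound : ∀ x ∈ s, ‖f'' x‖ ≤ M) {a b : E} (ha : a ∈ s) (hb : b ∈ s) :
    ‖f b - f a - f' a (b - a)‖ ≤ M / 2 * ‖b - a‖ ^ 2 := by
  have hmem : ∀ t ∈ Set.Icc (0 : ℝ) 1, a + t • (b - a) ∈ s := fun t ht =>
    hs.add_smul_sub_mem ha hb ht
  have hderiv : ∀ t ∈ Set.Icc (0 : ℝ) 1,
      HasDerivWithinAt (fun t : ℝ => f (a + t • (b - a)) - f a - t • f' a (b - a))
        (f' (a + t • (b - a)) (b - a) - f' a (b - a)) (Set.Icc 0 1) t := by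
    intro t ht
    have hline : HasDerivWithinAt (fun t : ℝ => a + t • (b - a)) (b - a) (Set.Icc 0 1) t := by
      simpa using (((hasDerivAt_id t).smul_const (b - a)).const_add a).hasDerivWithinAt
    have hcomp := (hf' _ (hmem t ht)).comp_hasDerivWithinAt t hline hmem
    have hlin : HasDerivWithinAt (fun t : ℝ => t • f' a (b - a)) (f' a (b - a))
        (Set.Icc 0 1) t := by
      simpa using ((hasDerivAt_id t).smul_const (f' a (b - a))).hasDerivWithinAt
    exact (hcomp.sub_const (f a)).sub hlin
  have hB : ∀ t : ℝ, HasDerivAt (fun t : ℝ => M / 2 * ‖b - a‖ ^ 2 * t ^ 2)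
      (M * ‖b - a‖ ^ 2 * t) t := by
    intro t
    refine ((hasDerivAt_pow 2 t).const_mul (M / 2 * ‖b - a‖ ^ 2)).congr_deriv ?_
    norm_num
    ring
  have key := image_norm_le_of_norm_deriv_right_le_deriv_boundary
    (fun t ht => (hderiv t ht).continuousWithinAt)
    (fun t ht => (hderiv t (Set.Ico_subset_Icc_self ht)).mono_of_mem_nhdsWithin
      (Icc_mem_nhdsGE_of_mem ht))
    (by simp) hB
    (fun t ht => by
      have h := hs.norm_image_sub_le_of_norm_hasFDerivWithin_le hf'' hbound ha
        (hmem t (Set.Ico_subset_Icc_self ht))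
      rw [add_sub_cancel_left, norm_smul, Real.norm_of_nonneg ht.1] at h
      rw [← sub_apply]
      calc _ ≤ ‖f' (a + t • (b - a)) - f' a‖ * ‖b - a‖ := ContinuousLinearMap.le_opNorm _ _
        _ ≤ M * (t * ‖b - a‖) * ‖b - a‖ := by gcongr
        _ = M * ‖b - a‖ ^ 2 * t := by ring)
    (Set.right_mem_Icc.2 zero_le_one)
  simpa using key

/-- Quantitative Lemma 1 (loss approximation): for a twice differentiable function `f`
on a convex set `s` with second derivative bounded by `M`, and an `L`-Lipschitz loss
`ℓ : ℝ → ℝ`, the loss of the weight-averaged model differs from the loss of the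
functional ensemble by at most `(L·M/2)·Δ²`, where `Δ = maxᵢ ‖θᵢ - θ̄‖`. -/
theorem tea_loss_approximation
    {E : Type*} [NormedAddCommGroup E] [NormedSpace ℝ E]
    (s : Set E) (hs : Convex ℝ s)
    (f : E → ℝ) (f' : E → E →L[ℝ] ℝ) (f'' : E → E →L[ℝ] E →L[ℝ] ℝ)
    (hf' : ∀ x ∈ s, HasFDerivWithinAt f (f' x) s x)
    (hf'' : ∀ x ∈ s, HasFDerivWithinAt f' (f'' x) s x)
    (M : ℝ) (hM : 0 ≤ M) (hbound : ∀ x ∈ s, ‖f'' x‖ ≤ M)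
    (S : ℕ) (hS : 0 < S)
    (θ : Fin S → E) (hθ : ∀ i, θ i ∈ s)
    (α : Fin S → ℝ) (hα : ∀ i, 0 ≤ α i) (hα1 : ∑ i, α i = 1)
    (θbar : E) (hθbar : θbar = ∑ i, α i • θ i)
    (Δ : ℝ)
    (hΔ : Δ = Finset.univ.sup' ⟨⟨0, hS⟩, Finset.mem_univ _⟩ (fun i => ‖θ i - θbar‖))
    (ℓ : ℝ → ℝ) (L : ℝ≥0) (hℓ : LipschitzWith L ℓ) :
    |ℓ (f θbar) - ℓ (∑ i, α i * f (θ i))| ≤ ((L : ℝ) * M / 2) * Δ ^ 2 := by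
  have hmem : θbar ∈ s := hθbar ▸ hs.sum_mem (fun i _ => hα i) hα1 (fun i _ => hθ i)
  have hcenter : ∑ i, α i • (θ i - θbar) = 0 := by
    simp only [smul_sub, sum_sub_distrib, ← sum_smul, hα1, one_smul, ← hθbar, sub_self]
  have hΔi : ∀ i, ‖θ i - θbar‖ ≤ Δ := fun i => by
    rw [hΔ]
    exact le_sup' (fun i => ‖θ i - θbar‖) (mem_univ i)
  have hlin : ∑ i, α i * f' θbar (θ i - θbar) = 0 := by
    simpa using congrArg (f' θbar) hcenter
  have hens : ∑ i, α i * f (θ i) - f θbar =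
      ∑ i, α i * (f (θ i) - f θbar - f' θbar (θ i - θbar)) := by
    simp only [mul_sub (α _), sum_sub_distrib, ← sum_mul, hα1, hlin, one_mul, sub_zero]
  have hdiff : |∑ i, α i * f (θ i) - f θbar| ≤ M / 2 * Δ ^ 2 := by
    rw [hens]
    calc _ ≤ ∑ i, |α i * (f (θ i) - f θbar - f' θbar (θ i - θbar))| := abs_sum_le_sum_abs _ _
      _ ≤ ∑ i, α i * (M / 2 * Δ ^ 2) := by
        refine sum_le_sum fun i _ => ?_
        rw [abs_mul, abs_of_nonneg (hα i)]
        refine mul_le_mul_of_nonneg_left ?_ (hα i)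
        refine (hs.norm_image_sub_sub_fderiv_le hf' hf'' hbound hmem (hθ i)).trans ?_
        gcongr
        exact hΔi i
      _ = M / 2 * Δ ^ 2 := by rw [← sum_mul, hα1, one_mul]
  calc |ℓ (f θbar) - ℓ (∑ i, α i * f (θ i))|
      ≤ L * |f θbar - ∑ i, α i * f (θ i)| := hℓ.dist_le_mul _ _
    _ ≤ L * (M / 2 * Δ ^ 2) := by
      rw [abs_sub_comm]
      gcongr
    _ = (L : ℝ) * M / 2 * Δ ^ 2 := by ring
end

section
/- Let σ_1, …, σ_S be nonnegative reals and let σ_* = min_{1≤i≤S} σ_i. For α = (α_1, …, α_S) in the probability simplex (α_i ≥ 0 and Σ_{i=1}^S α_i = 1), define F(α) = sup over all real symmetric positive semidefinite S×S matrices Σ with Σ_{ii} = σ_i² of the quadratic form αᵀ Σ α. Then min over the simplex of F equals σ_*², and it is attained by the vertex α* that places all weight on an index achieving the minimum σ_* (α*_{i₀} = 1 for some i₀ with σ_{i₀} = σ_*, and α*_i = 0 otherwise). -/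
open Finset Matrix

/-- Cauchy–Schwarz for the entries of a real positive semidefinite matrix. -/
theorem Matrix.PosSemidef.apply_le_mul_of_diag_eq_sq {ι : Type*} {A : Matrix ι ι ℝ}
    (hA : A.PosSemidef) {σ : ι → ℝ} (hσ : ∀ i, 0 ≤ σ i) (hd : ∀ i, A i i = σ i ^ 2)
    (i j : ι) : A i j ≤ σ i * σ j := by
  have hdet := (hA.submatrix ![i, j]).det_nonneg
  have hsymm : A j i = A i j := by simpa using hA.isHermitian.apply i j
  simp only [det_fin_two, submatrix_apply, cons_val_zero, cons_val_one, hd, hsymm] at hdet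
  exact le_of_sq_le_sq (by nlinarith) (mul_nonneg (hσ i) (hσ j))

/-- The largest value of `αᵀ A α` over positive semidefinite `A` with diagonal `σᵢ²` is
`(∑ αᵢ σᵢ)²`, attained at `A = σ σᵀ`. -/
theorem isGreatest_quadratic_form_of_diag_eq_sq {ι : Type*} [Fintype ι] {σ α : ι → ℝ}
    (hσ : ∀ i, 0 ≤ σ i) (hα : ∀ i, 0 ≤ α i) :
    IsGreatest {x : ℝ | ∃ A : Matrix ι ι ℝ,
      A.IsSymm ∧ A.PosSemidef ∧ (∀ i, A i i = σ i ^ 2) ∧ x = α ⬝ᵥ A.mulVec α}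
      ((∑ i, α i * σ i) ^ 2) := by
  constructor
  · refine ⟨vecMulVec σ σ, ?_, ?_, fun i => ?_, ?_⟩
    · ext i j
      simp [vecMulVec_apply, mul_comm]
    · simpa using posSemidef_vecMulVec_self_star σ
    · simp [vecMulVec_apply, sq]
    · rw [sq, sum_mul_sum]
      simp only [dotProduct, mulVec, vecMulVec_apply, mul_sum]
      exact sum_congr rfl fun i _ => sum_congr rfl fun j _ => by ring
  · rintro _ ⟨A, -, hA, hd, rfl⟩
    rw [sq, sum_mul_sum]
    simp only [dotProduct, mulVec, mul_sum]
    refine sum_le_sum fun i _ => sum_le_sum fun j _ => ?_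
    have h := mul_le_mul_of_nonneg_left (hA.apply_le_mul_of_diag_eq_sq hσ hd i j)
      (mul_nonneg (hα i) (hα j))
    linarith

/-- Optimal averaging coefficients for bias minimization: with `σ_* = minᵢ σᵢ` and
`F(α)` the supremum of the quadratic form `αᵀ A α` over real symmetric positive
semidefinite matrices `A` with diagonal `σᵢ²`, the minimum of `F` over the
probability simplex equals `σ_*²`, attained at a vertex placing all weight on an
index `i₀` achieving `σ_{i₀} = σ_*`. -/
theorem minimax_bias_coefficients
    (S : ℕ) (hS : 0 < S) (σ : Fin S → ℝ) (hσ : ∀ i, 0 ≤ σ i)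
    (σstar : ℝ)
    (hσstar : σstar = Finset.univ.inf' ⟨⟨0, hS⟩, Finset.mem_univ _⟩ σ)
    (F : (Fin S → ℝ) → ℝ)
    (hF : ∀ α : Fin S → ℝ,
      F α = sSup {x : ℝ | ∃ A : Matrix (Fin S) (Fin S) ℝ,
        A.IsSymm ∧ A.PosSemidef ∧ (∀ i, A i i = σ i ^ 2) ∧ x = α ⬝ᵥ A.mulVec α}) :
    IsLeast
      {y : ℝ | ∃ α : Fin S → ℝ, (∀ i, 0 ≤ α i) ∧ (∑ i, α i = 1) ∧ y = F α}
      (σstar ^ 2)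
    ∧ ∃ i₀ : Fin S, σ i₀ = σstar ∧ F (fun i => if i = i₀ then 1 else 0) = σstar ^ 2 := by
  have hF_eq (α : Fin S → ℝ) (hα : ∀ i, 0 ≤ α i) : F α = (∑ i, α i * σ i) ^ 2 :=
    (hF α).trans (isGreatest_quadratic_form_of_diag_eq_sq hσ hα).csSup_eq
  obtain ⟨i₀, -, hi₀⟩ := exists_mem_eq_inf' ⟨⟨0, hS⟩, mem_univ _⟩ σ
  rw [← hσstar] at hi₀
  have hmin (i : Fin S) : σstar ≤ σ i := hσstar ▸ inf'_le σ (mem_univ i)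
  have hvertex_nonneg (i : Fin S) : (0 : ℝ) ≤ if i = i₀ then 1 else 0 := by
    split_ifs <;> norm_num
  have hvertex : F (fun i => if i = i₀ then 1 else 0) = σstar ^ 2 := by
    rw [hF_eq _ hvertex_nonneg]
    simp [hi₀]
  refine ⟨⟨⟨_, hvertex_nonneg, by simp, hvertex.symm⟩, ?_⟩, i₀, hi₀.symm, hvertex⟩
  rintro _ ⟨α, hα, hsum, rfl⟩
  rw [hF_eq α hα]
  refine pow_le_pow_left₀ (hi₀ ▸ hσ i₀) ?_ 2
  calc σstar = ∑ i, α i * σstar := by rw [← sum_mul, hsum, one_mul]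
    _ ≤ ∑ i, α i * σ i := sum_le_sum fun i _ => mul_le_mul_of_nonneg_left (hmin i) (hα i)
end
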